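/- Let a ≥ 1, d ≥ 0, let μ = (μ_1 ≥ ··· ≥ μ_a ≥ 0) be a partition with at most a nonzero parts, each part ≤ d, and let l ≥ d + a. Working in Z[X_1,…,X_{a+1}], one has ∂_{s_1 s_2 ··· s_a}( X_{a+1}^l · m_μ(X_1,…,X_a) ) = m_{μ∪{l−a}}(X_1,…,X_{a+1}) + R, where μ∪{l−a} is the partition obtained from μ by adjoining the part l−a (note l−a ≥ d ≥ μ_1), and R is a polynomial symmetric in X_1,…,X_{a+1} with deg_*(R) < l − a (or R = 0). -/

import Mathlib

open scoped BigOperators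

namespace Dem

/-- The polynomial ring `ℤ[X_1, …, X_n]` (0-based variables). -/
abbrev R (n : ℕ) := MvPolynomial (Fin n) ℤ

/-- `D` is the family of Demazure (BGG) operators `∂_i` (0-based), characterized
by `(X_{i+1} - X_i) · ∂_i P = P - s_i(P)`. -/
def IsDemFamily {n : ℕ} (D : ℕ → R n → R n) : Prop :=
  ∀ (i : ℕ) (h : i + 1 < n) (P : R n),
    (MvPolynomial.X (⟨i + 1, h⟩ : Fin n) - MvPolynomial.X ⟨i, by omega⟩) * D i P
      = P - MvPolynomial.rename (Equiv.swap (⟨i, by omega⟩ : Fin n) ⟨i + 1, h⟩) P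

/-- `∂_w = ∂_{i_1} ∘ ⋯ ∘ ∂_{i_r}` for a word `l = [i_1, …, i_r]` (rightmost
applied first). -/
def applyWord {n : ℕ} (D : ℕ → R n → R n) (l : List ℕ) (P : R n) : R n :=
  l.foldr (fun i Q => D i Q) P

/-- The permutation of `Fin n` given by a word in the simple transpositions. -/
def permOfWord (n : ℕ) (l : List ℕ) : Equiv.Perm (Fin n) :=
  (l.map fun i =>
    if h : i + 1 < n then Equiv.swap (⟨i, by omega⟩ : Fin n) ⟨i + 1, h⟩ else 1).prod

/-- `l` is a reduced word for the permutation `w`. -/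
def IsReducedWordFor (n : ℕ) (l : List ℕ) (w : Equiv.Perm (Fin n)) : Prop :=
  (∀ i ∈ l, i + 1 < n) ∧ permOfWord n l = w ∧
    ∀ l' : List ℕ, (∀ i ∈ l', i + 1 < n) → permOfWord n l' = w → l.length ≤ l'.length

/-- The standard reduced word for the longest element of `S_m` (0-based). -/
def longWord (m : ℕ) : List ℕ :=
  (List.range m).foldr (fun j acc => (List.range j).reverse ++ acc) []

/-- The set of variables `X_{lo+1}, …, X_n` (0-based indices `≥ lo`). -/
def varsFrom (n lo : ℕ) : Finset (Fin n) :=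
  Finset.univ.filter fun a : Fin n => lo ≤ a.val

/-- The set of variables `X_1, …, X_m` (0-based indices `< m`). -/
def varsUpto (n m : ℕ) : Finset (Fin n) :=
  Finset.univ.filter fun a : Fin n => a.val < m

/-- Elementary symmetric polynomial of degree `m` in the variables of `s`. -/
noncomputable def eOn {n : ℕ} (s : Finset (Fin n)) (m : ℕ) : R n :=
  ∑ T ∈ s.powersetCard m, ∏ a ∈ T, MvPolynomial.X a

/-- Complete homogeneous symmetric polynomial of degree `j` in the variables of
`s`. -/
noncomputable def hOn {n : ℕ} (s : Finset (Fin n)) (j : ℕ) : R n :=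
  ∑ d ∈ s.sym j, (Multiset.map MvPolynomial.X (d : Multiset (Fin n))).prod

/-- `P` is symmetric in the variables with (0-based) index `≥ lo`. -/
def SymFrom {n : ℕ} (lo : ℕ) (P : R n) : Prop :=
  ∀ a b : Fin n, lo ≤ a.val → lo ≤ b.val →
    MvPolynomial.rename (Equiv.swap a b) P = P

/-- The monomial symmetric polynomial in the first `c` of the `n` variables,
attached to the exponent vector `w` (the sum of the distinct monomials in the
`S_c`-orbit of `X_1^{w_1} ⋯ X_c^{w_c}`). -/
noncomputable def msymBlock {n : ℕ} (c : ℕ) (w : Fin c → ℕ) : R n :=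
  ∑ g ∈ Finset.image
      (fun σ : Equiv.Perm (Fin c) =>
        fun i : Fin n => if h : i.val < c then w (σ ⟨i.val, h⟩) else 0)
      Finset.univ,
    ∏ i, MvPolynomial.X i ^ g i

end Dem

namespace Dem

open MvPolynomial

theorem X_sub_X_ne_zero {n : ℕ} {i j : Fin n} (hij : i ≠ j) : (X j - X i : R n) ≠ 0 :=
  sub_ne_zero.2 fun e => hij (X_injective e).symm

theorem degreeOf_X_sub_X {n : ℕ} {i j : Fin n} (hij : i ≠ j) :
    degreeOf i (X j - X i : R n) = 1 := by
  have : (X j - X i : R n) = -(X i + -X j) := by ring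
  rw [this, degreeOf_neg, degreeOf_add_eq_of_degreeOf_lt] <;>
    simp [degreeOf_neg, degreeOf_X_of_ne hij]

theorem degreeOf_le_of_X_sub_X_mul {n : ℕ} {i j : Fin n} (hij : i ≠ j) (k : Fin n) {m : ℕ}
    {P Q : R n} (h : (X j - X i) * P = Q) (hQ : degreeOf k Q ≤ m) : degreeOf k P ≤ m := by
  by_cases hP : P = 0
  · simp [hP]
  rw [← h, degreeOf_mul_eq (X_sub_X_ne_zero hij) hP] at hQ
  omega

theorem eq_zero_or_degreeOf_lt_of_X_sub_X_mul {n : ℕ} {i j : Fin n} (hij : i ≠ j) {m : ℕ}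
    {P Q : R n} (h : (X j - X i) * P = Q) (hQ : degreeOf i Q ≤ m) :
    P = 0 ∨ degreeOf i P < m := by
  refine or_iff_not_imp_left.2 fun hP => ?_
  rw [← h, degreeOf_mul_eq (X_sub_X_ne_zero hij) hP, degreeOf_X_sub_X hij] at hQ
  omega

theorem rename_rename_swap {n : ℕ} (i j : Fin n) (P : R n) :
    rename (Equiv.swap i j) (rename (Equiv.swap i j) P) = P := by
  rw [rename_rename, ← Equiv.coe_trans, Equiv.swap_swap]
  simp

theorem rename_swap_of_divided {n : ℕ} {i j : Fin n} (hij : i ≠ j) {P A : R n}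
    (h : (X j - X i) * A = P - rename (Equiv.swap i j) P) :
    rename (Equiv.swap i j) A = A := by
  have h' := congrArg (rename (Equiv.swap i j)) h
  simp only [map_mul, map_sub, rename_X, Equiv.swap_apply_left, Equiv.swap_apply_right,
    rename_rename_swap] at h'
  apply mul_left_cancel₀ (X_sub_X_ne_zero hij)
  linear_combination -h' - h

theorem rename_of_divided {n : ℕ} {i j : Fin n} (hij : i ≠ j) (σ : Equiv.Perm (Fin n))
    (hi : σ i = i) (hj : σ j = j) {P A : R n}
    (h : (X j - X i) * A = P - rename (Equiv.swap i j) P) (hP : rename σ P = P) :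
    rename σ A = A := by
  have hc : rename σ (rename (Equiv.swap i j) P) = rename (Equiv.swap i j) P := by
    conv_rhs => rw [← hP]
    rw [rename_rename, rename_rename]
    congr 2
    ext x
    have := Equiv.swap_apply_apply σ i j
    rw [hi, hj] at this
    conv_rhs => rw [this]
    simp
  have h' := congrArg (rename σ) h
  simp only [map_mul, map_sub, rename_X, hi, hj, hc, hP] at h'
  apply mul_left_cancel₀ (X_sub_X_ne_zero hij)
  rw [h', h]

theorem rename_swap_of_divided_divided {n : ℕ} {i j k : Fin n} (hij : i ≠ j) (hjk : j ≠ k)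
    (hik : i ≠ k) {G A C : R n}
    (hA : (X k - X j) * A = G - rename (Equiv.swap j k) G)
    (hC : (X j - X i) * C = A - rename (Equiv.swap i j) A)
    (hG : rename (Equiv.swap i j) G = G) : rename (Equiv.swap j k) C = C := by
  set s := rename (R := ℤ) (Equiv.swap i j) with hs
  set t := rename (R := ℤ) (Equiv.swap j k) with ht
  have htA : t A = A := rename_swap_of_divided hjk hA
  have hbraid : t (s (t G)) = s (t G) := by
    conv_rhs => rw [← hG]
    simp only [hs, ht, rename_rename]
    congr 2
    ext x
    simp only [Function.comp_apply, Equiv.swap_apply_def]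
    split_ifs <;> simp_all
  have hsA := congrArg s hA
  have htC := congrArg t hC
  have htsA := congrArg t hsA
  simp only [hs, ht, map_mul, map_sub, rename_X, Equiv.swap_apply_left, Equiv.swap_apply_right,
    Equiv.swap_apply_of_ne_of_ne hik.symm hjk.symm, Equiv.swap_apply_of_ne_of_ne hij hik]
    at hsA htC htsA
  simp only [← hs, ← ht, hG, htA, hbraid] at hsA htC htsA
  apply mul_left_cancel₀ (X_sub_X_ne_zero hij)
  apply mul_left_cancel₀ (X_sub_X_ne_zero hik)
  apply mul_left_cancel₀ (X_sub_X_ne_zero hjk)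
  linear_combination (X k - X j) * (X j - X i) * htC - (X k - X j) * (X k - X i) * hC
    + ((X j - X i) - (X k - X i)) * hA - (X k - X j) * htsA + (X k - X j) * hsA

theorem isSymmetric_of_rename_swap {a : ℕ} {P : R (a + 1)}
    (h : ∀ i : Fin a, rename (Equiv.swap i.castSucc i.succ) P = P) : P.IsSymmetric := by
  intro e
  have he : e ∈ Submonoid.closure
      (Set.range fun i : Fin a => Equiv.swap i.castSucc i.succ) := by
    rw [Equiv.Perm.mclosure_swap_castSucc_succ]; trivial
  induction he using Submonoid.closure_induction with
  | mem x hx => obtain ⟨i, rfl⟩ := hx; exact h i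
  | one => simp
  | mul x y _ _ hx hy => rw [Equiv.Perm.coe_mul, ← rename_rename, hy, hx]

section Orbit

/-- The set of rearrangements of a tuple. -/
def orbit {c : ℕ} (w : Fin c → ℕ) : Finset (Fin c → ℕ) :=
  Finset.univ.image fun σ : Equiv.Perm (Fin c) => w ∘ σ

theorem mem_orbit {c : ℕ} {w g : Fin c → ℕ} :
    g ∈ orbit w ↔ ∃ σ : Equiv.Perm (Fin c), w ∘ σ = g := by
  simp [orbit]

theorem comp_mem_orbit {c : ℕ} {w g : Fin c → ℕ} (hg : g ∈ orbit w)
    (e : Equiv.Perm (Fin c)) : g ∘ e ∈ orbit w := by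
  obtain ⟨σ, rfl⟩ := mem_orbit.1 hg
  exact mem_orbit.2 ⟨σ * e, rfl⟩

theorem msymBlock_self {c : ℕ} (w : Fin c → ℕ) :
    (msymBlock c w : R c) = ∑ g ∈ orbit w, ∏ i, X i ^ g i := by
  simp only [msymBlock, orbit]
  congr 2
  ext σ i
  simp

theorem msymBlock_succ {a : ℕ} (w : Fin a → ℕ) :
    (msymBlock a w : R (a + 1)) = rename Fin.castSucc (msymBlock a w : R a) := by
  have h : Finset.univ.image (fun (σ : Equiv.Perm (Fin a)) (i : Fin (a + 1)) =>
      if h : i.val < a then w (σ ⟨i.val, h⟩) else 0) =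
      (orbit w).image fun g => (Fin.snoc g 0 : Fin (a + 1) → ℕ) := by
    rw [orbit, Finset.image_image]
    congr 1
  rw [msymBlock_self, map_sum, msymBlock, h, Finset.sum_image]
  · refine Finset.sum_congr rfl fun g _ => ?_
    rw [Fin.prod_univ_castSucc]
    simp
  · intro g _ g' _ hgg
    exact (Fin.snoc_injective2 hgg).1

theorem isSymmetric_msymBlock {c : ℕ} (w : Fin c → ℕ) : (msymBlock c w : R c).IsSymmetric := by
  intro e
  rw [msymBlock_self, map_sum]
  refine Finset.sum_bij' (fun g _ => g ∘ e.symm) (fun g _ => g ∘ e)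
    (fun g hg => comp_mem_orbit hg _) (fun g hg => comp_mem_orbit hg _)
    (fun g _ => by ext; simp) (fun g _ => by ext; simp) fun g _ => ?_
  rw [map_prod, ← Equiv.prod_comp e fun i => X i ^ (g ∘ e.symm) i]
  simp

theorem degreeOf_prod_X_pow {n : ℕ} (g : Fin n → ℕ) (i : Fin n) :
    degreeOf i (∏ j, X j ^ g j : R n) = g i := by
  have h : (∏ j, X j ^ g j : R n) = monomial (Finsupp.equivFunOnFinite.symm g) 1 := by
    rw [monomial_eq, Finsupp.prod_fintype] <;> simp
  rw [h, degreeOf_monomial_eq _ _ one_ne_zero]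
  rfl

theorem degreeOf_msymBlock_le {c d : ℕ} {w : Fin c → ℕ} (hw : ∀ i, w i ≤ d) (i : Fin c) :
    degreeOf i (msymBlock c w : R c) ≤ d := by
  rw [msymBlock_self]
  refine (degreeOf_sum_le _ _ _).trans (Finset.sup_le fun g hg => ?_)
  obtain ⟨σ, rfl⟩ := mem_orbit.1 hg
  rw [degreeOf_prod_X_pow]
  exact hw _

theorem cons_mem_orbit_snoc {a M : ℕ} {w h : Fin a → ℕ} :
    (Fin.cons M h : Fin (a + 1) → ℕ) ∈ orbit (Fin.snoc w M : Fin (a + 1) → ℕ) ↔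
      h ∈ orbit w := by
  simp only [mem_orbit]
  constructor
  · rintro ⟨σ, hσ⟩
    have hM : (Fin.snoc w M : Fin (a + 1) → ℕ) (σ 0) = M := by simpa using congrFun hσ 0
    set ρ := σ.trans (Equiv.swap (σ 0) (Fin.last a)) with hρ
    have hρ0 : ρ 0 = Fin.last a := by simp [hρ]
    have hw : ∀ x, (Fin.snoc w M : Fin (a + 1) → ℕ) (ρ x) =
        (Fin.snoc w M : Fin (a + 1) → ℕ) (σ x) := by
      intro x
      simp only [hρ, Equiv.trans_apply, Equiv.swap_apply_def]
      split_ifs with h1 h2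
      · rw [h1, hM]; simp
      · rw [h2, hM]; simp
      · rfl
    have hne : ∀ i : Fin a, ρ i.succ ≠ Fin.last a := fun i e =>
      Fin.succ_ne_zero i (ρ.injective (e.trans hρ0.symm))
    have hinj : Function.Injective fun i : Fin a => (ρ i.succ).castPred (hne i) := by
      intro i j hij
      simpa using hij
    refine ⟨Equiv.ofBijective _ (Finite.injective_iff_bijective.1 hinj), funext fun i => ?_⟩
    have h1 := (hw i.succ).trans (congrFun hσ i.succ)
    rw [← Fin.castSucc_castPred (ρ i.succ) (hne i), Fin.snoc_castSucc] at h1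
    exact h1
  · rintro ⟨τ, rfl⟩
    have hinj : Function.Injective
        (Fin.cons (Fin.last a) (Fin.castSucc ∘ τ) : Fin (a + 1) → Fin (a + 1)) := by
      rw [Fin.cons_injective_iff]
      refine ⟨?_, (Fin.castSucc_injective a).comp τ.injective⟩
      rintro ⟨i, hi⟩
      exact (Fin.castSucc_lt_last (τ i)).ne hi
    refine ⟨Equiv.ofBijective _ (Finite.injective_iff_bijective.1 hinj), funext fun i => ?_⟩
    refine Fin.cases ?_ (fun i => ?_) i <;> simp

/-- The part of `m_{μ ∪ {M}}` of top degree `M` in the first variable is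
`X_1^M m_μ(X_2, …, X_{a+1})`. -/
theorem msymBlock_snoc_sub {a M : ℕ} {w : Fin a → ℕ} (hw : ∀ i, w i ≤ M) :
    (msymBlock (a + 1) (Fin.snoc w M) : R (a + 1))
        - X 0 ^ M * rename Fin.succ (msymBlock a w : R a) = 0 ∨
      degreeOf 0 ((msymBlock (a + 1) (Fin.snoc w M) : R (a + 1))
        - X 0 ^ M * rename Fin.succ (msymBlock a w : R a)) < M := by
  have htop : ∑ g ∈ (orbit (Fin.snoc w M : Fin (a + 1) → ℕ)) with g 0 = M,
      (∏ i, X i ^ g i : R (a + 1)) = X 0 ^ M * rename Fin.succ (msymBlock a w : R a) := by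
    rw [msymBlock_self, map_sum, Finset.mul_sum]
    symm
    refine Finset.sum_bij' (fun h _ => Fin.cons M h) (fun g _ => Fin.tail g) ?_ ?_ ?_ ?_ ?_
    · intro h hh
      simpa using cons_mem_orbit_snoc.2 hh
    · intro g hg
      obtain ⟨hg, h0⟩ := Finset.mem_filter.1 hg
      rw [← cons_mem_orbit_snoc (M := M), ← h0, Fin.cons_self_tail]
      simpa [h0] using hg
    · intro h _
      simp
    · intro g hg
      rw [← (Finset.mem_filter.1 hg).2, Fin.cons_self_tail]
    · intro h _
      simp [Fin.prod_univ_succ]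
  rw [msymBlock_self, ← Finset.sum_filter_add_sum_filter_not _ (fun g => g 0 = M), htop,
    add_sub_cancel_left]
  refine or_iff_not_imp_left.2 fun hne => ?_
  have hlt : ∀ g ∈ (orbit (Fin.snoc w M : Fin (a + 1) → ℕ)).filter (fun g => ¬ g 0 = M),
      g 0 < M := by
    intro g hg
    obtain ⟨hg, h0⟩ := Finset.mem_filter.1 hg
    refine lt_of_le_of_ne ?_ h0
    obtain ⟨σ, rfl⟩ := mem_orbit.1 hg
    have hs : ∀ x, (Fin.snoc w M : Fin (a + 1) → ℕ) x ≤ M :=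
      Fin.lastCases (by simp) (by simp [hw])
    exact hs (σ 0)
  obtain ⟨g, hg, -⟩ := Finset.exists_ne_zero_of_sum_ne_zero hne
  refine (degreeOf_sum_le _ _ _).trans_lt ((Finset.sup_lt_iff (Nat.zero_le _ |>.trans_lt
    (hlt g hg))).2 fun g hg => ?_)
  rw [degreeOf_prod_X_pow]
  exact hlt g hg

end Orbit

section Demazure

variable {a : ℕ} {D : ℕ → R (a + 1) → R (a + 1)}

theorem IsDemFamily.rename_swap_applyWord (hD : IsDemFamily D) {G : R (a + 1)}
    (hG : ∀ (i : ℕ) (h : i + 1 < a),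
      rename (Equiv.swap (⟨i, by omega⟩ : Fin (a + 1)) ⟨i + 1, by omega⟩) G = G)
    (m : ℕ) : ∀ k, k + m = a → ∀ (i : ℕ) (h : i + 1 < a + 1), i + 1 ≠ k →
      rename (Equiv.swap (⟨i, by omega⟩ : Fin (a + 1)) ⟨i + 1, h⟩)
        (applyWord D (List.range' k m) G) = applyWord D (List.range' k m) G := by
  induction m using Nat.strong_induction_on with
  | _ m ih =>
  intro k hk i h hik
  obtain _ | m := m
  · exact hG i (by omega)
  · have hC := hD k (by omega) (applyWord D (List.range' (k + 1) m) G)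
    change rename _ (D k (applyWord D (List.range' (k + 1) m) G))
      = D k (applyWord D (List.range' (k + 1) m) G)
    by_cases h1 : i = k
    · subst h1
      exact rename_swap_of_divided (by simp) hC
    by_cases h2 : i = k + 1
    · subst h2
      obtain _ | m := m
      · omega
      · have hA := hD (k + 1) (by omega) (applyWord D (List.range' (k + 2) m) G)
        exact rename_swap_of_divided_divided (by simp) (by simp)
          (by simp only [ne_eq, Fin.mk.injEq]; omega) hA hC
          (ih m (by omega) (k + 2) (by omega) k (by omega) (by omega))
    · refine rename_of_divided (by simp) _ (Equiv.swap_apply_of_ne_of_ne ?_ ?_)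
        (Equiv.swap_apply_of_ne_of_ne ?_ ?_) hC
        (ih m (by omega) (k + 1) (by omega) i h (by omega)) <;>
      simp only [ne_eq, Fin.mk.injEq] <;> omega

theorem rename_swap_rename_succAbove {k : ℕ} (hk : k + 1 < a + 1) (P : R a) :
    rename (Equiv.swap (⟨k, by omega⟩ : Fin (a + 1)) ⟨k + 1, hk⟩)
        (rename (Fin.succAbove ⟨k + 1, hk⟩) P) =
      rename (Fin.succAbove ⟨k, by omega⟩) P := by
  rw [rename_rename]
  congr 2
  ext x
  simp only [Function.comp_apply, Fin.succAbove, Equiv.swap_apply_def, Fin.lt_def, Fin.ext_iff]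
  split_ifs <;> simp_all <;> omega

theorem degreeOf_rename_succAbove_self (k : Fin (a + 1)) (P : R a) :
    degreeOf k (rename k.succAbove P) = 0 := by
  classical
  by_contra h
  have := vars_rename _ _ (mem_vars_iff_degreeOf_ne_zero.2 h)
  simp [Fin.succAbove_ne] at this

theorem degreeOf_rename_succAbove_le {d : ℕ} {P : R a} (hP : ∀ i, degreeOf i P ≤ d)
    (k i : Fin (a + 1)) : degreeOf i (rename k.succAbove P) ≤ d := by
  obtain rfl | ⟨j, rfl⟩ := Fin.eq_self_or_eq_succAbove k i
  · simp [degreeOf_rename_succAbove_self]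
  · rw [degreeOf_rename_of_injective Fin.succAbove_right_injective]
    exact hP j

/-- Modulo terms of lower degree in `X_k`, applying `∂_k ∘ ⋯ ∘ ∂_a` to
`X_{a+1}^l P(X_1, …, X_a)` gives a power of `X_k` times `P` in the other variables. -/
theorem IsDemFamily.exists_applyWord_eq (hD : IsDemFamily D) {d M : ℕ} (hM : d ≤ M) {P : R a}
    (hP : ∀ i, degreeOf i P ≤ d) (m : ℕ) : ∀ k (hk : k + m = a), ∃ E : R (a + 1),
      applyWord D (List.range' k m)
          (X (Fin.last a) ^ (M + a) * rename Fin.castSucc P) =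
        X ⟨k, by omega⟩ ^ (M + k) * rename (Fin.succAbove ⟨k, by omega⟩) P + E ∧
      (E = 0 ∨ degreeOf ⟨k, by omega⟩ E < M + k) ∧
      ∀ (j : ℕ) (hj : j < k), degreeOf ⟨j, by omega⟩ E ≤ d := by
  induction m with
  | zero =>
    intro k hk
    obtain rfl : k = a := hk
    refine ⟨0, ?_, Or.inl rfl, by simp⟩
    have : (Fin.last k).succAbove = Fin.castSucc := Fin.succAbove_last
    rw [add_zero, ← this]
    rfl
  | succ m ih =>
    intro k hk
    obtain ⟨E, hF, hE, hE'⟩ := ih (k + 1) (by omega)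
    have hE₁ : degreeOf (⟨k + 1, by omega⟩ : Fin (a + 1)) E ≤ M + k := by
      rcases hE with rfl | hE
      · simp
      · omega
    have hxy : (⟨k, by omega⟩ : Fin (a + 1)) ≠ ⟨k + 1, by omega⟩ := by simp
    have hC := hD k (by omega) (applyWord D (List.range' (k + 1) m)
      (X (Fin.last a) ^ (M + a) * rename Fin.castSucc P))
    have hr := rename_swap_rename_succAbove (a := a) (k := k) (by omega) P
    have hr₀ := degreeOf_rename_succAbove_self (⟨k, by omega⟩ : Fin (a + 1)) P
    have hrd := degreeOf_rename_succAbove_le hP (⟨k, by omega⟩ : Fin (a + 1))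
    have hrd' := degreeOf_rename_succAbove_le hP (⟨k + 1, by omega⟩ : Fin (a + 1))
    change ∃ E', D k (applyWord D (List.range' (k + 1) m)
      (X (Fin.last a) ^ (M + a) * rename Fin.castSucc P)) = _ ∧ _
    generalize applyWord D (List.range' (k + 1) m)
      (X (Fin.last a) ^ (M + a) * rename Fin.castSucc P) = F at hF hC ⊢
    generalize D k F = C at hC ⊢
    have hswE (j : Fin (a + 1)) :=
      degreeOf_rename_of_injective (p := E) (Equiv.swap (⟨k, by omega⟩ : Fin (a + 1))
        ⟨k + 1, by omega⟩).injective j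
    have hswl := hswE ⟨k + 1, by omega⟩
    rw [Equiv.swap_apply_right] at hswl
    have hswj (j : ℕ) (hj : j < k) := hswE ⟨j, by omega⟩
    rw [hF, map_add, map_mul, map_pow, rename_X, Equiv.swap_apply_right, hr] at hC
    generalize rename (Fin.succAbove (⟨k, by omega⟩ : Fin (a + 1))) P = r at *
    generalize rename (Fin.succAbove (⟨k + 1, by omega⟩ : Fin (a + 1))) P = r' at *
    generalize rename (Equiv.swap (⟨k, by omega⟩ : Fin (a + 1)) ⟨k + 1, by omega⟩) E = E₂ at *
    have key : (X ⟨k + 1, by omega⟩ - X ⟨k, by omega⟩) *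
        (C - X ⟨k, by omega⟩ ^ (M + k) * r) =
        (X ⟨k + 1, by omega⟩ ^ (M + k + 1) * r' + E)
          - (E₂ + X ⟨k + 1, by omega⟩ * (X ⟨k, by omega⟩ ^ (M + k) * r)) := by
      linear_combination hC
    have bound (j : Fin (a + 1)) (b : ℕ) (hj : j ≠ ⟨k + 1, by omega⟩)
        (h1 : degreeOf j r' ≤ b) (h2 : degreeOf j E ≤ b) (h3 : degreeOf j E₂ ≤ b)
        (h4 : degreeOf j (X ⟨k, by omega⟩ ^ (M + k) : R (a + 1)) + degreeOf j r ≤ b) :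
        degreeOf j ((X ⟨k + 1, by omega⟩ ^ (M + k + 1) * r' + E)
          - (E₂ + X ⟨k + 1, by omega⟩ * (X ⟨k, by omega⟩ ^ (M + k) * r))) ≤ b := by
      refine (degreeOf_sub_le _ _ _).trans (max_le ((degreeOf_add_le _ _ _).trans (max_le ?_ h2))
        ((degreeOf_add_le _ _ _).trans (max_le h3 ?_)))
      · refine (degreeOf_mul_le _ _ _).trans ?_
        rwa [degreeOf_X_pow_of_ne _ hj, zero_add]
      · refine (degreeOf_mul_le _ _ _).trans ?_
        rw [degreeOf_X_of_ne hj, zero_add]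
        exact (degreeOf_mul_le _ _ _).trans h4
    refine ⟨C - X ⟨k, by omega⟩ ^ (M + k) * r, by ring, ?_, fun j hj => ?_⟩
    · refine eq_zero_or_degreeOf_lt_of_X_sub_X_mul hxy key (bound _ _ hxy ?_ ?_ ?_ ?_)
      · exact (hrd' _).trans (by omega)
      · exact (hE' k (by omega)).trans (by omega)
      · rw [hswl]; exact hE₁
      · rw [degreeOf_X_self_pow, hr₀, add_zero]
    · have hjk : (⟨j, by omega⟩ : Fin (a + 1)) ≠ ⟨k, by omega⟩ := by
        simp only [ne_eq, Fin.mk.injEq]; omega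
      have hjk' : (⟨j, by omega⟩ : Fin (a + 1)) ≠ ⟨k + 1, by omega⟩ := by
        simp only [ne_eq, Fin.mk.injEq]; omega
      refine degreeOf_le_of_X_sub_X_mul hxy _ key (bound _ _ hjk' (hrd' _) (hE' j (by omega)) ?_ ?_)
      · have := hswj j hj
        rw [Equiv.swap_apply_of_ne_of_ne hjk hjk'] at this
        rw [this]
        exact hE' j (by omega)
      · rw [degreeOf_X_pow_of_ne _ hjk, zero_add]
        exact hrd _

end Demazure

end Dem

open Dem in
/-- For a partition `μ` with at most `a` parts, each `≤ d`,
and `l ≥ d + a`, one has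
`∂_{s_1⋯s_a}(X_{a+1}^l · m_μ(X_1,…,X_a)) = m_{μ∪{l-a}}(X_1,…,X_{a+1}) + R`
with `R` symmetric and `deg_* R < l - a` (or `R = 0`). -/
theorem statement12 (a d l : ℕ) (ha : 1 ≤ a) (hl : d + a ≤ l)
    (μ : Fin a → ℕ) (hmono : Antitone μ) (hle : ∀ i, μ i ≤ d)
    (D : ℕ → R (a + 1) → R (a + 1)) (hD : IsDemFamily D) :
    ∃ Rp : R (a + 1),
      applyWord D (List.range a)
          (MvPolynomial.X (Fin.last a) ^ l * msymBlock a μ)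
        = msymBlock (a + 1) (Fin.snoc μ (l - a)) + Rp ∧
      Rp.IsSymmetric ∧
      (Rp = 0 ∨ ∀ idx : Fin (a + 1), MvPolynomial.degreeOf idx Rp < l - a) := by
  open MvPolynomial in
  have hsym : (applyWord D (List.range a)
      (MvPolynomial.X (Fin.last a) ^ l * msymBlock a μ)).IsSymmetric := by
    refine isSymmetric_of_rename_swap fun i => ?_
    rw [List.range_eq_range']
    refine hD.rename_swap_applyWord (fun i h => ?_) a 0 (by omega) i (by omega) (by omega)
    have hl₁ : Fin.last a ≠ ⟨i, by omega⟩ := by simp [Fin.ext_iff]; omega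
    have hl₂ : Fin.last a ≠ ⟨i + 1, by omega⟩ := by simp [Fin.ext_iff]; omega
    rw [map_mul, map_pow, rename_X, Equiv.swap_apply_of_ne_of_ne hl₁ hl₂, msymBlock_succ]
    congr 1
    conv_rhs => rw [← isSymmetric_msymBlock μ
      (Equiv.swap (⟨i, by omega⟩ : Fin a) ⟨i + 1, by omega⟩)]
    rw [rename_rename, rename_rename]
    congr 2
    exact _root_.funext fun x => (Fin.castSucc_injective a).swap_apply
      ⟨i, by omega⟩ ⟨i + 1, by omega⟩ x
  refine ⟨_, (add_sub_cancel _ _).symm, ?_, ?_⟩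
  · exact hsym.sub (isSymmetric_msymBlock _)
  have hS := hsym.sub (isSymmetric_msymBlock (Fin.snoc μ (l - a) : Fin (a + 1) → ℕ))
  obtain ⟨E, hF, hE, -⟩ := hD.exists_applyWord_eq (M := l - a) (d := d) (by omega)
    (degreeOf_msymBlock_le hle) a 0 (by omega)
  rw [Nat.sub_add_cancel (by omega), ← msymBlock_succ, ← List.range_eq_range'] at hF
  have hE₂ := msymBlock_snoc_sub (w := μ) (M := l - a) fun i => (hle i).trans (by omega)
  set T := applyWord D (List.range a) (MvPolynomial.X (Fin.last a) ^ l * msymBlock a μ)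
    - msymBlock (a + 1) (Fin.snoc μ (l - a)) with hT
  have hzero : T = 0 ∨ MvPolynomial.degreeOf 0 T < l - a := by
    generalize hE' : (msymBlock (a + 1) (Fin.snoc μ (l - a)) : R (a + 1))
      - MvPolynomial.X 0 ^ (l - a) * MvPolynomial.rename Fin.succ (msymBlock a μ : R a) = E' at hE₂
    have hTE : T = E - E' := by
      rw [hT, hF, ← hE']
      have : Fin.succAbove (⟨0, by omega⟩ : Fin (a + 1)) = Fin.succ := Fin.succAbove_zero
      rw [this, add_zero]
      change MvPolynomial.X 0 ^ (l - a) * _ + E - _ = _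
      ring
    rw [hTE]
    rcases hE with rfl | hE
    · simpa [MvPolynomial.degreeOf_neg] using hE₂
    · rcases hE₂ with rfl | hE₂
      · right; simpa using hE
      · exact Or.inr ((MvPolynomial.degreeOf_sub_le _ _ _).trans_lt (max_lt hE hE₂))
  refine hzero.imp_right fun h idx => ?_
  have := MvPolynomial.degreeOf_rename_of_injective (p := T) (Equiv.swap 0 idx).injective 0
  rw [Equiv.swap_apply_left, hS] at this
  rwa [this]
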